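/- Let (X, d) be a nonempty compact metric space with diameter D_X > 0, let (xₙ) be a dense sequence in X, let q > 1, c_φ = √(q²−1)/q, N ≥ 2. Define φ(x) = (c_φ·d(x, xₙ)/qⁿ)_{n∈ℕ} ∈ ℓ², φ_t(x) = (c_φ·d(x, xₙ)/qⁿ)_{n=0}^{N−1} ∈ ℝ^N, and B_t : ℝ^N → ℓ² the padding map B_t(u) = (u₀, …, u_{N−1}, 0, 0, …). Let (aₙ) be positive reals such that K(t) = ∑ₙ aₙ tⁿ converges absolutely for |t| ≤ 4·D_X², and let C = max_{t ∈ [−4D_X², 4D_X²]} |K'(t)|. Then for every m ∈ ℕ, all z₁, …, z_m ∈ X and all reals a₁, …, a_m: sup_{x ∈ X} |∑_{i=1}^m aᵢ (K(⟨φ(zᵢ), φ(x)⟩_{ℓ²}) − K(⟨φ(zᵢ), B_t(φ_t(x))⟩_{ℓ²}))| ≤ q^{−N/2}·D_X·√(2C) · √(∑_{i,j} aᵢ aⱼ K(⟨φ(zᵢ), φ(zⱼ)⟩_{ℓ²})). -/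

import Mathlib

open Finset

/-- Cauchy–Schwarz inequality for a real positive semidefinite matrix. -/
theorem Matrix.PosSemidef.abs_dotProduct_mulVec_le_sqrt_mul_sqrt {ι : Type*} [Fintype ι] [DecidableEq ι]
    {G : Matrix ι ι ℝ} (hG : G.PosSemidef) (v w : ι → ℝ) :
    |v ⬝ᵥ G.mulVec w| ≤ √(v ⬝ᵥ G.mulVec v) * √(w ⬝ᵥ G.mulVec w) := by
  have hB : ∀ x y, Matrix.toBilin' G x y = x ⬝ᵥ G.mulVec y := Matrix.toBilin'_apply' G
  have hnonneg : ∀ x, 0 ≤ x ⬝ᵥ G.mulVec x := fun x => by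
    simpa using hG.dotProduct_mulVec_nonneg x
  have hT : G.transpose = G := by simpa using hG.isHermitian.eq
  have hsymm : LinearMap.IsSymm (Matrix.toBilin' G) := ⟨fun x y => by
    rw [RingHom.id_apply, hB, hB, dotProduct_mulVec, ← mulVec_transpose, hT, dotProduct_comm]⟩
  have h := (Matrix.toBilin' G).apply_sq_le_of_symm
    (fun x => (hnonneg x).trans_eq (hB x x).symm) hsymm v w
  simp only [hB] at h
  rw [← Real.sqrt_mul (hnonneg v)]
  exact Real.abs_le_sqrt h

section TaylorKernel

variable {E : Type*} [NormedAddCommGroup E] [InnerProductSpace ℝ E]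

theorem posSemidef_inner_pow {ι : Type*} [Finite ι] (u : ι → E) (n : ℕ) :
    (Matrix.of fun i j => inner ℝ (u i) (u j) ^ n).PosSemidef := by
  induction n with
  | zero =>
    convert! Matrix.posSemidef_gram ℝ (fun _ : ι => (1 : ℝ)) using 1
    ext i j
    simp [Matrix.gram]
  | succ n ih =>
    convert! ih.hadamard (Matrix.posSemidef_gram ℝ u) using 1

theorem posSemidef_tsum_inner_pow {ι : Type*} [Fintype ι] (u : ι → E) {a : ℕ → ℝ}
    (ha : ∀ n, 0 ≤ a n)
    (hs : ∀ i j, Summable fun n => a n * inner ℝ (u i) (u j) ^ n) :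
    (Matrix.of fun i j => ∑' n, a n * inner ℝ (u i) (u j) ^ n).PosSemidef := by
  refine Matrix.PosSemidef.of_dotProduct_mulVec_nonneg ?_ fun w => ?_
  · ext i j
    simp [real_inner_comm]
  · have key : HasSum (fun n => a n *
        (star w ⬝ᵥ (Matrix.of fun i j => inner ℝ (u i) (u j) ^ n).mulVec w))
        (star w ⬝ᵥ (Matrix.of fun i j => ∑' n, a n * inner ℝ (u i) (u j) ^ n).mulVec w) := by
      simp only [dotProduct, Matrix.mulVec, Matrix.of_apply]
      simp only [mul_sum]
      refine hasSum_sum fun i _ => hasSum_sum fun j _ => ?_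
      convert! ((hs i j).hasSum.mul_right (w j)).mul_left (star w i) using 1
      ext n
      ring
    exact key.nonneg fun n =>
      mul_nonneg (ha n) ((posSemidef_inner_pow u n).dotProduct_mulVec_nonneg w)

/-- The reproducing-kernel estimate `|f x - f y| ≤ ‖f‖ ‖k x - k y‖` for the kernel expansion
`f = ∑ i, c i * k (z i)` of a Taylor kernel. -/
theorem abs_sum_taylorKernel_sub_le {ι : Type*} [Fintype ι] {a : ℕ → ℝ} (ha : ∀ n, 0 ≤ a n)
    {K : ℝ → ℝ} (hK : ∀ t, K t = ∑' n, a n * t ^ n) {r : ℝ}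
    (hs : ∀ t, |t| ≤ r ^ 2 → Summable fun n => a n * t ^ n)
    {z : ι → E} (hz : ∀ i, ‖z i‖ ≤ r) (c : ι → ℝ) {x y : E} (hx : ‖x‖ ≤ r) (hy : ‖y‖ ≤ r) :
    |∑ i, c i * (K (inner ℝ (z i) x) - K (inner ℝ (z i) y))| ≤
      √(∑ i, ∑ j, c i * c j * K (inner ℝ (z i) (z j))) *
        √(K (inner ℝ x x) - 2 * K (inner ℝ x y) + K (inner ℝ y y)) := by
  classical
  let u : ι ⊕ Fin 2 → E := Sum.elim z ![x, y]
  have hu : ∀ i, ‖u i‖ ≤ r := by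
    rintro (i | i)
    · exact hz i
    · fin_cases i
      exacts [hx, hy]
  have hG := posSemidef_tsum_inner_pow u ha fun i j => hs _ <| by
    calc |inner ℝ (u i) (u j)| ≤ ‖u i‖ * ‖u j‖ := abs_real_inner_le_norm _ _
      _ ≤ r * r := mul_le_mul (hu i) (hu j) (norm_nonneg _) ((norm_nonneg _).trans (hu i))
      _ = r ^ 2 := (sq r).symm
  simp only [← hK] at hG
  have h := hG.abs_dotProduct_mulVec_le_sqrt_mul_sqrt (Sum.elim c 0) (Sum.elim 0 ![1, -1])
  simp only [dotProduct, Matrix.mulVec, Matrix.of_apply, Fintype.sum_sum_type, u, Sum.elim_inl,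
    Sum.elim_inr, Fin.sum_univ_two, Pi.zero_apply, Matrix.cons_val_zero, Matrix.cons_val_one,
    zero_mul, mul_zero, sum_const_zero, add_zero, zero_add, mul_one, one_mul, mul_neg,
    neg_mul] at h
  convert! h using 3
  · simp only [mul_sum]
    exact sum_congr rfl fun i _ => sum_congr rfl fun j _ => by ring
  · rw [real_inner_comm x y]
    ring

end TaylorKernel

theorem differentiableAt_tsum_mul_pow {a : ℕ → ℝ} {r t : ℝ} (hr : Summable fun n => |a n * r ^ n|)
    (ht : |t| < r) : DifferentiableAt ℝ (fun s => ∑' n, a n * s ^ n) t := by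
  have hr0 : 0 < r := (abs_nonneg t).trans_lt ht
  let p := FormalMultilinearSeries.ofScalars ℝ a
  have hrad : ENNReal.ofReal r ≤ p.radius := by
    refine p.le_radius_of_summable (r := r.toNNReal) ?_
    simpa [p, abs_mul, abs_of_pos hr0, hr0.le] using hr
  have hp := p.hasFPowerSeriesOnBall (lt_of_lt_of_le (by simpa using hr0) hrad)
  have hmem : t ∈ Metric.eball (0 : ℝ) p.radius := by
    refine Metric.eball_subset_eball hrad ?_
    rw [Metric.eball_ofReal]
    simpa using ht
  convert! (hp.analyticAt_of_mem hmem).differentiableAt using 1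
  ext s
  exact (FormalMultilinearSeries.ofScalars_sum_eq a s).symm

/-- Tails of the squared norm of a sequence dominated by a geometric one. -/
theorem tsum_sq_nat_add_le_of_geometric {q D : ℝ} (hq : 1 < q) {f : ℕ → ℝ}
    (hf : ∀ n, f n ^ 2 ≤ (q ^ 2 - 1) / q ^ 2 * D ^ 2 * (1 / q ^ 2) ^ n) (N : ℕ) :
    ∑' n, f (n + N) ^ 2 ≤ D ^ 2 * (1 / q ^ 2) ^ N := by
  have hq2 : 1 < q ^ 2 := one_lt_pow₀ hq two_ne_zero
  have hg := (hasSum_geometric_of_lt_one (r := 1 / q ^ 2) (by positivity)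
    ((div_lt_one (by positivity)).2 hq2)).mul_left
      ((q ^ 2 - 1) / q ^ 2 * D ^ 2 * (1 / q ^ 2) ^ N)
  have hle : ∀ n, f (n + N) ^ 2 ≤
      (q ^ 2 - 1) / q ^ 2 * D ^ 2 * (1 / q ^ 2) ^ N * (1 / q ^ 2) ^ n := fun n =>
    (hf _).trans_eq (by ring)
  have hs : Summable fun n => f (n + N) ^ 2 :=
    hg.summable.of_nonneg_of_le (fun n => sq_nonneg _) hle
  refine (hs.tsum_le_tsum hle hg.summable).trans_eq ?_
  rw [hg.tsum_eq]
  have : q ^ 2 - 1 ≠ 0 := by linarith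
  have : q ^ 2 ≠ 0 := by positivity
  field_simp


/-- Approximation of the universal Taylor kernel `k(x,y) = K(⟨φ x, φ y⟩)` by
its truncated version `K(⟨φ x, B_t(φ_t y)⟩)`: the uniform error over `x ∈ X`
of any finite kernel expansion `∑ᵢ aᵢ k(zᵢ, ·)` is bounded by
`q^{−N/2}·D_X·√(2C) · √(∑_{i,j} aᵢ aⱼ k(zᵢ, zⱼ))`. -/
theorem taylor_approx_universal_truncation
    {X : Type*} [MetricSpace X] [CompactSpace X] [Nonempty X]
    (hD : 0 < Metric.diam (Set.univ : Set X))
    (x_ : ℕ → X) (hdense : ∀ (x : X) (ε : ℝ), 0 < ε → ∃ n, dist x (x_ n) ≤ ε)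
    (q : ℝ) (hq : 1 < q) (N : ℕ) (hN : 2 ≤ N)
    (φ : X → lp (fun _ : ℕ => ℝ) 2)
    (hφ : ∀ (x : X) (n : ℕ),
      φ x n = Real.sqrt (q ^ 2 - 1) / q * dist x (x_ n) / q ^ n)
    (φt : X → EuclideanSpace ℝ (Fin N))
    (hφt : ∀ (x : X) (n : Fin N),
      φt x n = Real.sqrt (q ^ 2 - 1) / q * dist x (x_ n) / q ^ (n : ℕ))
    (Bt : EuclideanSpace ℝ (Fin N) → lp (fun _ : ℕ => ℝ) 2)
    (hBt : ∀ (u : EuclideanSpace ℝ (Fin N)) (n : ℕ),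
      Bt u n = if h : n < N then u ⟨n, h⟩ else 0)
    (a : ℕ → ℝ) (ha : ∀ n, 0 < a n)
    (hconv : ∀ t : ℝ, |t| ≤ 4 * Metric.diam (Set.univ : Set X) ^ 2 →
      Summable fun n : ℕ => |a n * t ^ n|)
    (K : ℝ → ℝ) (hK : ∀ t : ℝ, K t = ∑' n : ℕ, a n * t ^ n)
    (C : ℝ)
    (hC : IsGreatest ((fun t => |deriv K t|) ''
      Set.Icc (-(4 * Metric.diam (Set.univ : Set X) ^ 2))
        (4 * Metric.diam (Set.univ : Set X) ^ 2)) C) :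
    ∀ (m : ℕ) (z : Fin m → X) (c : Fin m → ℝ) (x : X),
      |∑ i, c i * (K (inner (𝕜 := ℝ) (φ (z i)) (φ x)) -
          K (inner (𝕜 := ℝ) (φ (z i)) (Bt (φt x))))| ≤
        Real.sqrt (1 / q ^ N) * Metric.diam (Set.univ : Set X) *
          Real.sqrt (2 * C) *
          Real.sqrt (∑ i, ∑ j,
            c i * c j * K (inner (𝕜 := ℝ) (φ (z i)) (φ (z j)))) := by
  intro m z c x
  set D := Metric.diam (Set.univ : Set X)
  have hq0 : 0 < q := one_pos.trans hq
  have hq2 : 0 < q ^ 2 - 1 := by nlinarith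
  have hgeom : ∀ y n, φ y n ^ 2 ≤ (q ^ 2 - 1) / q ^ 2 * D ^ 2 * (1 / q ^ 2) ^ n := fun y n => by
    have hd : dist y (x_ n) ≤ D :=
      Metric.dist_le_diam_of_mem isCompact_univ.isBounded (Set.mem_univ _) (Set.mem_univ _)
    have h2 : dist y (x_ n) ^ 2 ≤ D ^ 2 := pow_le_pow_left₀ dist_nonneg hd 2
    calc φ y n ^ 2 = (q ^ 2 - 1) / q ^ 2 * dist y (x_ n) ^ 2 * (1 / q ^ 2) ^ n := by
          rw [hφ, div_pow, mul_pow, div_pow, Real.sq_sqrt hq2.le, one_div, inv_pow, ← pow_mul,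
            ← pow_mul, mul_comm 2 n, div_eq_mul_inv _ (q ^ (n * 2))]
      _ ≤ _ := by gcongr
  have hsum_inner : ∀ u v : lp (fun _ : ℕ => ℝ) 2, HasSum (fun n => u n * v n) (inner ℝ u v) :=
    fun u v => by
      simpa [mul_comm] using lp.hasSum_inner (𝕜 := ℝ) u v
  have hself : ∀ y, HasSum (fun n => φ y n ^ 2) (inner ℝ (φ y) (φ y)) := fun y => by
    simpa only [sq] using hsum_inner (φ y) (φ y)
  have hnorm : ∀ y, inner ℝ (φ y) (φ y) ≤ D ^ 2 := fun y => by
    rw [← (hself y).tsum_eq]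
    simpa using tsum_sq_nat_add_le_of_geometric hq (hgeom y) 0
  have hnorm_le : ∀ y, ‖φ y‖ ≤ D := fun y => by
    have h := hnorm y
    rw [real_inner_self_eq_norm_sq] at h
    exact le_of_sq_le_sq h hD.le
  set v := Bt (φt x)
  have hv : ∀ n, v n = if n < N then φ x n else 0 := fun n => by
    simp only [v, hBt, hφt, hφ]
    split_ifs <;> rfl
  have hxv : inner ℝ (φ x) v = ∑ n ∈ range N, φ x n ^ 2 := by
    refine (hsum_inner _ _).unique ?_
    rw [sum_congr rfl fun n hn => show φ x n ^ 2 = φ x n * v n by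
      rw [hv, if_pos (mem_range.1 hn), sq]]
    refine hasSum_sum_of_ne_finset_zero fun n hn => ?_
    rw [hv, if_neg (by simpa using hn), mul_zero]
  have hvv : inner ℝ v v = inner ℝ (φ x) v := by
    rw [← (hsum_inner v v).tsum_eq, ← (hsum_inner (φ x) v).tsum_eq]
    refine tsum_congr fun n => ?_
    rw [hv]
    split_ifs <;> simp
  have htail : inner ℝ (φ x) (φ x) - inner ℝ (φ x) v ≤ D ^ 2 * (1 / q ^ 2) ^ N := by
    have h := (hself x).summable.sum_add_tsum_nat_add N
    rw [(hself x).tsum_eq] at h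
    rw [hxv]
    linarith [tsum_sq_nat_add_le_of_geometric hq (hgeom x) N]
  have hle : inner ℝ v v ≤ inner ℝ (φ x) (φ x) := by
    rw [hvv, hxv]
    exact sum_le_hasSum _ (fun n _ => sq_nonneg _) (hself x)
  have hvD : ‖v‖ ≤ D := by
    have h := hle.trans (hnorm x)
    rw [real_inner_self_eq_norm_sq] at h
    exact le_of_sq_le_sq h hD.le
  have hD2 : 0 < D ^ 2 := by positivity
  have hbound : ∀ t ∈ Set.Icc (0 : ℝ) (D ^ 2), DifferentiableAt ℝ K t ∧ ‖deriv K t‖ ≤ C := by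
    intro t ht
    refine ⟨?_, hC.2 ⟨t, ⟨by linarith [ht.1], by linarith [ht.2]⟩, rfl⟩⟩
    rw [show K = fun t => ∑' n, a n * t ^ n from funext hK]
    refine differentiableAt_tsum_mul_pow (hconv (4 * D ^ 2) (abs_of_pos (by positivity)).le) ?_
    rw [abs_of_nonneg ht.1]
    linarith [ht.2]
  have hC0 : 0 ≤ C := (norm_nonneg _).trans (hbound 0 ⟨le_rfl, hD2.le⟩).2
  have hmvt : K (inner ℝ (φ x) (φ x)) - K (inner ℝ (φ x) v) ≤ C * (D ^ 2 * (1 / q ^ 2) ^ N) := by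
    have h := (convex_Icc (0 : ℝ) (D ^ 2)).norm_image_sub_le_of_norm_deriv_le
      (fun t ht => (hbound t ht).1) (fun t ht => (hbound t ht).2)
      ⟨real_inner_self_nonneg (x := v), hle.trans (hnorm x)⟩
      ⟨real_inner_self_nonneg (x := φ x), hnorm x⟩
    rw [Real.norm_of_nonneg (sub_nonneg.2 hle), hvv] at h
    exact (le_abs_self _).trans (h.trans (by gcongr))
  have hcs := abs_sum_taylorKernel_sub_le (fun n => (ha n).le) hK
    (fun t ht => (hconv t (by linarith)).of_abs) (fun i => hnorm_le (z i)) c (hnorm_le x) hvD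
  rw [hvv] at hcs
  have hpow : (1 / q ^ 2) ^ N ≤ 1 / q ^ N := by
    rw [one_div, inv_pow, ← pow_mul, ← one_div]
    exact one_div_le_one_div_of_le (by positivity) (pow_le_pow_right₀ hq.le (by omega))
  have hR : K (inner ℝ (φ x) (φ x)) - 2 * K (inner ℝ (φ x) v) + K (inner ℝ (φ x) v) ≤
      1 / q ^ N * D ^ 2 * (2 * C) := by
    calc _ ≤ C * (D ^ 2 * (1 / q ^ 2) ^ N) := by linarith
      _ ≤ (2 * C) * (D ^ 2 * (1 / q ^ N)) := by
        gcongr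
        linarith
      _ = _ := by ring
  calc _ ≤ _ := hcs
    _ ≤ _ * √(1 / q ^ N * D ^ 2 * (2 * C)) := by gcongr
    _ = _ := by
      rw [Real.sqrt_mul (by positivity), Real.sqrt_mul (by positivity), Real.sqrt_sq hD.le,
        mul_comm]
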